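/- Let 𝔤 be the ageing algebra 𝔞 or the extended Schrödinger algebra 𝒮, and let V and W be simple weight 𝔤-modules. If for some ḣ ∈ supp(V) the weight spaces V_ḣ and W_ḣ are isomorphic as modules over the centralizer U(𝔤)₀ of h in U(𝔤), then V and W are isomorphic as 𝔤-modules. -/

import Mathlib

set_option synthInstance.maxHeartbeats 1000000
set_option maxHeartbeats 2000000

noncomputable section

/-- The ageing Lie algebra `𝔞`: a complex Lie algebra with basis `{E, H, P, Q, Z}` and
nonzero brackets `[H,E] = 2E`, `[H,P] = P`, `[H,Q] = -Q`, `[E,Q] = P`, `[P,Q] = Z`,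
with `Z` central and all other brackets of basis elements zero. -/
structure IsAgeingBasis (𝔞 : Type*) [LieRing 𝔞] [LieAlgebra ℂ 𝔞]
    (E H P Q Z : 𝔞) : Prop where
  indep : LinearIndependent ℂ ![E, H, P, Q, Z]
  span : Submodule.span ℂ {E, H, P, Q, Z} = ⊤
  lie_he : ⁅H, E⁆ = (2 : ℂ) • E
  lie_hp : ⁅H, P⁆ = P
  lie_hq : ⁅H, Q⁆ = -Q
  lie_eq : ⁅E, Q⁆ = P
  lie_pq : ⁅P, Q⁆ = Z
  lie_ep : ⁅E, P⁆ = 0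
  lie_ez : ⁅E, Z⁆ = 0
  lie_hz : ⁅H, Z⁆ = 0
  lie_pz : ⁅P, Z⁆ = 0
  lie_qz : ⁅Q, Z⁆ = 0

/-- The extended Schrödinger Lie algebra `𝒮` in `(1+1)`-dimensional space-time: a
complex Lie algebra with basis `{F, E, H, P, Q, Z}` and nonzero brackets
`[H,E] = 2E`, `[E,F] = H`, `[H,F] = -2F`, `[E,Q] = P`, `[H,P] = P`, `[F,P] = Q`,
`[H,Q] = -Q`, `[P,Q] = Z`, with `Z` central and all other brackets of basis elements
zero. -/
structure IsSchrodingerBasis (𝒮 : Type*) [LieRing 𝒮] [LieAlgebra ℂ 𝒮]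
    (F E H P Q Z : 𝒮) : Prop where
  indep : LinearIndependent ℂ ![F, E, H, P, Q, Z]
  span : Submodule.span ℂ {F, E, H, P, Q, Z} = ⊤
  lie_he : ⁅H, E⁆ = (2 : ℂ) • E
  lie_ef : ⁅E, F⁆ = H
  lie_hf : ⁅H, F⁆ = -((2 : ℂ) • F)
  lie_eq : ⁅E, Q⁆ = P
  lie_hp : ⁅H, P⁆ = P
  lie_fp : ⁅F, P⁆ = Q
  lie_hq : ⁅H, Q⁆ = -Q
  lie_pq : ⁅P, Q⁆ = Z
  lie_ep : ⁅E, P⁆ = 0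
  lie_fq : ⁅F, Q⁆ = 0
  lie_ez : ⁅E, Z⁆ = 0
  lie_fz : ⁅F, Z⁆ = 0
  lie_hz : ⁅H, Z⁆ = 0
  lie_pz : ⁅P, Z⁆ = 0
  lie_qz : ⁅Q, Z⁆ = 0

/-- `U₀ = U(𝔤)₀`, the centralizer of `h` in the universal enveloping algebra `U(𝔤)`. -/
def U0 {𝔤 : Type*} [LieRing 𝔤] [LieAlgebra ℂ 𝔤] (H : 𝔤) :
    Subalgebra ℂ (UniversalEnvelopingAlgebra ℂ 𝔤) :=
  Subalgebra.centralizer ℂ {UniversalEnvelopingAlgebra.ι ℂ H}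

/-- The action of the universal enveloping algebra `U(𝔤)` on a Lie module `V`. -/
def uAction (𝔤 : Type*) [LieRing 𝔤] [LieAlgebra ℂ 𝔤]
    (V : Type*) [AddCommGroup V] [Module ℂ V] [LieRingModule 𝔤 V] [LieModule ℂ 𝔤 V] :
    UniversalEnvelopingAlgebra ℂ 𝔤 →ₐ[ℂ] Module.End ℂ V :=
  UniversalEnvelopingAlgebra.lift ℂ (LieModule.toEnd ℂ 𝔤 V)

section AdjointWeights

variable {A : Type*} [Ring A] [Algebra ℂ A]

/-- The commutator `x ↦ a * x - x * a` as a linear endomorphism. -/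
def commutatorEnd (a : A) : Module.End ℂ A :=
  LinearMap.mulLeft ℂ a - LinearMap.mulRight ℂ a

theorem mem_eigenspace_commutatorEnd {a x : A} {μ : ℂ} :
    x ∈ (commutatorEnd a).eigenspace μ ↔ a * x - x * a = μ • x := by
  simp [commutatorEnd]

/-- The subalgebra spanned by the eigenvectors of the commutator with `a`. -/
def commutatorWeightSubalgebra (a : A) : Subalgebra ℂ A :=
  (⨆ μ : ℂ, (commutatorEnd a).eigenspace μ).toSubalgebra
    (Submodule.mem_iSup_of_mem 0 (mem_eigenspace_commutatorEnd.2 (by simp)))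
    (by
      intro x y hx hy
      have hmul : (⨆ μ : ℂ, (commutatorEnd a).eigenspace μ) *
          (⨆ μ : ℂ, (commutatorEnd a).eigenspace μ) ≤
            ⨆ μ : ℂ, (commutatorEnd a).eigenspace μ := by
        rw [Submodule.iSup_mul]
        refine iSup_le fun μ => ?_
        rw [Submodule.mul_iSup]
        refine iSup_le fun ν => Submodule.mul_le.2 fun m hm n hn => ?_
        refine Submodule.mem_iSup_of_mem (μ + ν) ?_
        rw [mem_eigenspace_commutatorEnd] at hm hn ⊢
        calc a * (m * n) - m * n * a = (a * m - m * a) * n + m * (a * n - n * a) := by noncomm_ring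
          _ = (μ + ν) • (m * n) := by
            rw [hm, hn, smul_mul_assoc, mul_smul_comm, add_smul]
      exact hmul (Submodule.mul_mem_mul hx hy))

theorem mem_commutatorWeightSubalgebra {a x : A} :
    x ∈ commutatorWeightSubalgebra a ↔ x ∈ ⨆ μ : ℂ, (commutatorEnd a).eigenspace μ :=
  Iff.rfl

end AdjointWeights

section Enveloping

attribute [local instance] LieRing.ofAssociativeRing

variable {𝔤 : Type*} [LieRing 𝔤] [LieAlgebra ℂ 𝔤]

theorem UniversalEnvelopingAlgebra.eq_top_of_forall_ι_mem
    (S : Subalgebra ℂ (UniversalEnvelopingAlgebra ℂ 𝔤))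
    (hS : ∀ x : 𝔤, UniversalEnvelopingAlgebra.ι ℂ x ∈ S) : S = ⊤ := by
  let f : 𝔤 →ₗ⁅ℂ⁆ S :=
    { toFun := fun x => ⟨UniversalEnvelopingAlgebra.ι ℂ x, hS x⟩
      map_add' := fun x y => Subtype.ext (map_add _ x y)
      map_smul' := fun c x => Subtype.ext (map_smul _ c x)
      map_lie' := fun {x y} => Subtype.ext (by
        simp [LieRing.of_associative_ring_bracket]) }
  have hf : S.val.comp (UniversalEnvelopingAlgebra.lift ℂ f) = AlgHom.id ℂ _ := by
    apply UniversalEnvelopingAlgebra.hom_ext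
    ext x
    change ((UniversalEnvelopingAlgebra.lift ℂ f (UniversalEnvelopingAlgebra.ι ℂ x) : S) :
      UniversalEnvelopingAlgebra ℂ 𝔤) = UniversalEnvelopingAlgebra.ι ℂ x
    rw [UniversalEnvelopingAlgebra.lift_ι_apply]
    rfl
  refine eq_top_iff.2 fun u _ => ?_
  have hu : ((UniversalEnvelopingAlgebra.lift ℂ f u : S) : UniversalEnvelopingAlgebra ℂ 𝔤) = u :=
    DFunLike.congr_fun hf u
  exact hu ▸ (UniversalEnvelopingAlgebra.lift ℂ f u).2

theorem ι_mul_sub_mul_ι (x y : 𝔤) :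
    UniversalEnvelopingAlgebra.ι ℂ x * UniversalEnvelopingAlgebra.ι ℂ y -
      UniversalEnvelopingAlgebra.ι ℂ y * UniversalEnvelopingAlgebra.ι ℂ x =
        UniversalEnvelopingAlgebra.ι ℂ ⁅x, y⁆ := by
  rw [LieHom.map_lie, LieRing.of_associative_ring_bracket]

theorem iSup_eigenspace_commutatorEnd_ι {H : 𝔤}
    (hH : ⨆ μ : ℂ, Module.End.eigenspace (LieAlgebra.ad ℂ 𝔤 H) μ = ⊤) :
    ⨆ μ : ℂ, (commutatorEnd (UniversalEnvelopingAlgebra.ι ℂ H)).eigenspace μ = ⊤ := by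
  have hle : ⨆ μ : ℂ, Module.End.eigenspace (LieAlgebra.ad ℂ 𝔤 H) μ ≤
      (⨆ μ : ℂ, (commutatorEnd (UniversalEnvelopingAlgebra.ι ℂ H)).eigenspace μ).comap
        (UniversalEnvelopingAlgebra.ι ℂ (L := 𝔤)).toLinearMap := by
    refine iSup_le fun μ x hx => Submodule.mem_iSup_of_mem μ ?_
    rw [Module.End.mem_eigenspace_iff, LieAlgebra.ad_apply] at hx
    rw [mem_eigenspace_commutatorEnd]
    exact (ι_mul_sub_mul_ι H x).trans (by rw [hx, map_smul]; rfl)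
  have htop := UniversalEnvelopingAlgebra.eq_top_of_forall_ι_mem
    (commutatorWeightSubalgebra (UniversalEnvelopingAlgebra.ι ℂ H))
    fun x => hle (hH ▸ Submodule.mem_top)
  refine eq_top_iff.2 fun u _ => ?_
  rw [← mem_commutatorWeightSubalgebra, htop]
  exact Algebra.mem_top

theorem mem_U0_iff {H : 𝔤} {u : UniversalEnvelopingAlgebra ℂ 𝔤} :
    u ∈ U0 H ↔ u ∈ (commutatorEnd (UniversalEnvelopingAlgebra.ι ℂ H)).eigenspace 0 := by
  rw [mem_eigenspace_commutatorEnd, zero_smul, sub_eq_zero, U0, Subalgebra.mem_centralizer_iff]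
  simp only [Set.mem_singleton_iff, forall_eq]

variable {V : Type*} [AddCommGroup V] [Module ℂ V] [LieRingModule 𝔤 V] [LieModule ℂ 𝔤 V]

theorem uAction_ι (x : 𝔤) (v : V) :
    uAction 𝔤 V (UniversalEnvelopingAlgebra.ι ℂ x) v = ⁅x, v⁆ := by
  rw [uAction, UniversalEnvelopingAlgebra.lift_ι_apply]
  rfl

/-- The orbit map `u ↦ u v`. -/
def uOrbit (𝔤 : Type*) [LieRing 𝔤] [LieAlgebra ℂ 𝔤] {V : Type*} [AddCommGroup V] [Module ℂ V]
    [LieRingModule 𝔤 V] [LieModule ℂ 𝔤 V] (v : V) : UniversalEnvelopingAlgebra ℂ 𝔤 →ₗ[ℂ] V :=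
  (LinearMap.applyₗ v).comp (uAction 𝔤 V).toLinearMap

theorem uOrbit_apply (v : V) (u : UniversalEnvelopingAlgebra ℂ 𝔤) :
    uOrbit 𝔤 v u = uAction 𝔤 V u v := rfl

theorem uOrbit_ι_mul (x : 𝔤) (u : UniversalEnvelopingAlgebra ℂ 𝔤) (v : V) :
    uOrbit 𝔤 v (UniversalEnvelopingAlgebra.ι ℂ x * u) = ⁅x, uOrbit 𝔤 v u⁆ := by
  rw [uOrbit_apply, map_mul, Module.End.mul_apply, uAction_ι, uOrbit_apply]

theorem uAction_mem_eigenspace {H : 𝔤} {u : UniversalEnvelopingAlgebra ℂ 𝔤} {v : V} {μ c : ℂ}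
    (hu : u ∈ (commutatorEnd (UniversalEnvelopingAlgebra.ι ℂ H)).eigenspace μ)
    (hv : v ∈ Module.End.eigenspace (LieModule.toEnd ℂ 𝔤 V H) c) :
    uAction 𝔤 V u v ∈ Module.End.eigenspace (LieModule.toEnd ℂ 𝔤 V H) (c + μ) := by
  rw [Module.End.mem_eigenspace_iff, LieModule.toEnd_apply_apply] at hv ⊢
  rw [mem_eigenspace_commutatorEnd, sub_eq_iff_eq_add] at hu
  rw [← uAction_ι, ← Module.End.mul_apply, ← map_mul, hu, map_add, map_smul, map_mul,
    LinearMap.add_apply, LinearMap.smul_apply, Module.End.mul_apply, uAction_ι, hv, map_smul,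
    add_smul, add_comm]

/-- If `H` acts diagonalizably on `𝔤`, every `u` in `U(𝔤)` differs from an element of the
centralizer of `H` by a sum of elements of nonzero weight. -/
theorem exists_mem_U0_sub_mem {H : 𝔤}
    (hH : ⨆ μ : ℂ, Module.End.eigenspace (LieAlgebra.ad ℂ 𝔤 H) μ = ⊤)
    (u : UniversalEnvelopingAlgebra ℂ 𝔤) :
    ∃ u₀ ∈ U0 H, u - u₀ ∈ ⨆ μ : ℂ, ⨆ _ : μ ≠ 0,
      (commutatorEnd (UniversalEnvelopingAlgebra.ι ℂ H)).eigenspace μ := by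
  have hu : u ∈ (commutatorEnd (UniversalEnvelopingAlgebra.ι ℂ H)).eigenspace 0 ⊔
      ⨆ μ : ℂ, ⨆ _ : μ ≠ 0,
        (commutatorEnd (UniversalEnvelopingAlgebra.ι ℂ H)).eigenspace μ := by
    rw [← iSup_split_single, iSup_eigenspace_commutatorEnd_ι hH]
    exact Submodule.mem_top
  obtain ⟨u₀, h₀, u', h', rfl⟩ := Submodule.mem_sup.1 hu
  exact ⟨u₀, mem_U0_iff.2 h₀, by simpa using h'⟩

/-- The weight-zero component of `u` acts as `u` on a weight vector whose weight `u` preserves. -/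
theorem uAction_eq_of_sub_mem {H : 𝔤} {u u₀ : UniversalEnvelopingAlgebra ℂ 𝔤} (hu₀ : u₀ ∈ U0 H)
    (hu : u - u₀ ∈ ⨆ μ : ℂ, ⨆ _ : μ ≠ 0,
      (commutatorEnd (UniversalEnvelopingAlgebra.ι ℂ H)).eigenspace μ)
    {v : V} {c : ℂ} (hv : v ∈ Module.End.eigenspace (LieModule.toEnd ℂ 𝔤 V H) c)
    (huv : uAction 𝔤 V u v ∈ Module.End.eigenspace (LieModule.toEnd ℂ 𝔤 V H) c) :
    uAction 𝔤 V u₀ v = uAction 𝔤 V u v := by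
  have h₀ : uAction 𝔤 V u₀ v ∈ Module.End.eigenspace (LieModule.toEnd ℂ 𝔤 V H) c := by
    simpa using uAction_mem_eigenspace (mem_U0_iff.1 hu₀) hv
  have hle : (⨆ μ : ℂ, ⨆ _ : μ ≠ 0,
      (commutatorEnd (UniversalEnvelopingAlgebra.ι ℂ H)).eigenspace μ) ≤
      (⨆ ν : ℂ, ⨆ _ : ν ≠ c, Module.End.eigenspace (LieModule.toEnd ℂ 𝔤 V H) ν).comap
        (uOrbit 𝔤 v) := by
    refine iSup₂_le fun μ hμ x hx => ?_
    exact Submodule.mem_iSup_of_mem (c + μ) (Submodule.mem_iSup_of_mem (by simpa using hμ)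
      (uAction_mem_eigenspace hx hv))
  have hd := hle hu
  rw [Submodule.mem_comap, map_sub, uOrbit_apply, uOrbit_apply] at hd
  have hdisj := (Module.End.eigenspaces_iSupIndep (LieModule.toEnd ℂ 𝔤 V H)) c
  exact (sub_eq_zero.1 (Submodule.disjoint_def.1 hdisj _ (sub_mem huv h₀) hd)).symm

theorem uOrbit_surjective (hV : LieModule.IsIrreducible ℂ 𝔤 V) {v : V} (hv : v ≠ 0) :
    Function.Surjective (uOrbit 𝔤 v) := by
  let N : LieSubmodule ℂ 𝔤 V :=
    { LinearMap.range (uOrbit 𝔤 v) with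
      lie_mem := by
        rintro x _ ⟨u, rfl⟩
        exact ⟨_, uOrbit_ι_mul x u v⟩ }
  have hvN : v ∈ N := ⟨1, by simp [uOrbit_apply]⟩
  have hN : N = ⊤ := (eq_bot_or_eq_top N).resolve_left fun h => hv (by simpa [h] using hvN)
  intro y
  have hy : y ∈ N := hN ▸ LieSubmodule.mem_top y
  exact hy

variable {W : Type*} [AddCommGroup W] [Module ℂ W] [LieRingModule 𝔤 W] [LieModule ℂ 𝔤 W]

theorem ker_uOrbit_le_ker_uOrbit {H : 𝔤}
    (hH : ⨆ μ : ℂ, Module.End.eigenspace (LieAlgebra.ad ℂ 𝔤 H) μ = ⊤)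
    (hW : LieModule.IsIrreducible ℂ 𝔤 W) {c : ℂ} {v : V} {w : W}
    (hv : v ∈ Module.End.eigenspace (LieModule.toEnd ℂ 𝔤 V H) c)
    (hw : w ∈ Module.End.eigenspace (LieModule.toEnd ℂ 𝔤 W H) c) (hw0 : w ≠ 0)
    (hann : ∀ u ∈ U0 H, uAction 𝔤 V u v = 0 → uAction 𝔤 W u w = 0) :
    LinearMap.ker (uOrbit 𝔤 v) ≤ LinearMap.ker (uOrbit 𝔤 w) := by
  let N : LieSubmodule ℂ 𝔤 W :=
    { (LinearMap.ker (uOrbit 𝔤 v)).map (uOrbit 𝔤 w) with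
      lie_mem := by
        rintro x _ ⟨u, hu, rfl⟩
        refine ⟨_, ?_, uOrbit_ι_mul x u w⟩
        have hu' : uOrbit 𝔤 v u = 0 := hu
        exact LinearMap.mem_ker.2 (by rw [uOrbit_ι_mul, hu', lie_zero]) }
  have hN : N = ⊥ := by
    by_contra hne
    have hwN : w ∈ N := by
      rw [(eq_bot_or_eq_top N).resolve_left hne]
      exact LieSubmodule.mem_top w
    obtain ⟨u, hu, huw⟩ := hwN
    have hu : uAction 𝔤 V u v = 0 := hu
    have huw : uAction 𝔤 W u w = w := huw
    obtain ⟨u₀, hu₀, hsub⟩ := exists_mem_U0_sub_mem hH u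
    have h1 := uAction_eq_of_sub_mem hu₀ hsub hv (hu ▸ zero_mem _)
    have h2 := uAction_eq_of_sub_mem hu₀ hsub hw (by rwa [huw])
    exact hw0 (by rw [← huw, ← h2, hann u₀ hu₀ (h1.trans hu)])
  intro u hu
  have hmem : uOrbit 𝔤 w u ∈ N := ⟨u, hu, rfl⟩
  simpa [hN] using hmem

theorem nonempty_lieModuleEquiv_of_ker_uOrbit_eq (hV : LieModule.IsIrreducible ℂ 𝔤 V)
    (hW : LieModule.IsIrreducible ℂ 𝔤 W) {v : V} {w : W} (hv : v ≠ 0) (hw : w ≠ 0)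
    (hker : LinearMap.ker (uOrbit 𝔤 v) = LinearMap.ker (uOrbit 𝔤 w)) :
    Nonempty (V ≃ₗ⁅ℂ,𝔤⁆ W) := by
  let e : V ≃ₗ[ℂ] W :=
    ((uOrbit 𝔤 v).quotKerEquivOfSurjective (uOrbit_surjective hV hv)).symm ≪≫ₗ
      Submodule.quotEquivOfEq _ _ hker ≪≫ₗ
        (uOrbit 𝔤 w).quotKerEquivOfSurjective (uOrbit_surjective hW hw)
  have he : ∀ u, e (uOrbit 𝔤 v u) = uOrbit 𝔤 w u := fun u => by
    have hu : ((uOrbit 𝔤 v).quotKerEquivOfSurjective (uOrbit_surjective hV hv)).symm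
        (uOrbit 𝔤 v u) = Submodule.Quotient.mk u := by
      rw [LinearEquiv.symm_apply_eq]
      rfl
    simp only [e, LinearEquiv.trans_apply, hu]
    rfl
  refine ⟨{ e with map_lie' := ?_ }⟩
  intro x y
  obtain ⟨u, rfl⟩ := uOrbit_surjective hV hv y
  change e ⁅x, uOrbit 𝔤 v u⁆ = ⁅x, e (uOrbit 𝔤 v u)⁆
  rw [← uOrbit_ι_mul, he, he, uOrbit_ι_mul]

end Enveloping

section Diagonalizable

variable {𝔤 : Type*} [LieRing 𝔤] [LieAlgebra ℂ 𝔤] {F E H P Q Z : 𝔤}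

theorem IsAgeingBasis.iSup_eigenspace_ad (hG : IsAgeingBasis 𝔤 E H P Q Z) :
    ⨆ μ : ℂ, Module.End.eigenspace (LieAlgebra.ad ℂ 𝔤 H) μ = ⊤ := by
  rw [eq_top_iff, ← hG.span, Submodule.span_le]
  rintro x (rfl | rfl | rfl | rfl | rfl)
  · exact Submodule.mem_iSup_of_mem 2 (by simp [hG.lie_he])
  · exact Submodule.mem_iSup_of_mem 0 (by simp)
  · exact Submodule.mem_iSup_of_mem 1 (by simp [hG.lie_hp])
  · exact Submodule.mem_iSup_of_mem (-1) (by simp [hG.lie_hq])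
  · exact Submodule.mem_iSup_of_mem 0 (by simp [hG.lie_hz])

theorem IsSchrodingerBasis.iSup_eigenspace_ad (hG : IsSchrodingerBasis 𝔤 F E H P Q Z) :
    ⨆ μ : ℂ, Module.End.eigenspace (LieAlgebra.ad ℂ 𝔤 H) μ = ⊤ := by
  rw [eq_top_iff, ← hG.span, Submodule.span_le]
  rintro x (rfl | rfl | rfl | rfl | rfl | rfl)
  · exact Submodule.mem_iSup_of_mem (-2) (by simp [hG.lie_hf])
  · exact Submodule.mem_iSup_of_mem 2 (by simp [hG.lie_he])
  · exact Submodule.mem_iSup_of_mem 0 (by simp)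
  · exact Submodule.mem_iSup_of_mem 1 (by simp [hG.lie_hp])
  · exact Submodule.mem_iSup_of_mem (-1) (by simp [hG.lie_hq])
  · exact Submodule.mem_iSup_of_mem 0 (by simp [hG.lie_hz])

end Diagonalizable

/-- Let `𝔤` be the ageing algebra `𝔞` or the extended Schrödinger
algebra `𝒮`, and let `V` and `W` be simple weight `𝔤`-modules.  If for some
`H`-eigenvalue `hc` of `V` the weight spaces `V_hc` and `W_hc` are isomorphic as modules
over the centralizer `U(𝔤)₀` of `h` in `U(𝔤)`, then `V ≅ W` as `𝔤`-modules. -/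
theorem simple_weight_module_determined_by_weight_space
    {𝔤 : Type*} [LieRing 𝔤] [LieAlgebra ℂ 𝔤] {E H P Q Z : 𝔤}
    (hG : IsAgeingBasis 𝔤 E H P Q Z ∨ ∃ F : 𝔤, IsSchrodingerBasis 𝔤 F E H P Q Z)
    {V : Type*} [AddCommGroup V] [Module ℂ V] [LieRingModule 𝔤 V] [LieModule ℂ 𝔤 V]
    {W : Type*} [AddCommGroup W] [Module ℂ W] [LieRingModule 𝔤 W] [LieModule ℂ 𝔤 W]
    (hsimpleV : LieModule.IsIrreducible ℂ 𝔤 V)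
    (hsimpleW : LieModule.IsIrreducible ℂ 𝔤 W)
    (zV : ℂ) (hzV : ∀ v : V, ⁅Z, v⁆ = zV • v)
    (zW : ℂ) (hzW : ∀ w : W, ⁅Z, w⁆ = zW • w)
    (hwtV : ⨆ μ : ℂ, Module.End.eigenspace (LieModule.toEnd ℂ 𝔤 V H) μ = ⊤)
    (hwtW : ⨆ μ : ℂ, Module.End.eigenspace (LieModule.toEnd ℂ 𝔤 W H) μ = ⊤)
    (hc : ℂ) (hev : Module.End.HasEigenvalue (LieModule.toEnd ℂ 𝔤 V H) hc)
    (hiso : ∃ ψ : Module.End.eigenspace (LieModule.toEnd ℂ 𝔤 V H) hc ≃ₗ[ℂ]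
        Module.End.eigenspace (LieModule.toEnd ℂ 𝔤 W H) hc,
      ∀ (u : U0 H)
        (v v' : Module.End.eigenspace (LieModule.toEnd ℂ 𝔤 V H) hc),
        uAction 𝔤 V (u : UniversalEnvelopingAlgebra ℂ 𝔤) (v : V) = (v' : V) →
        uAction 𝔤 W (u : UniversalEnvelopingAlgebra ℂ 𝔤) (ψ v : W) = (ψ v' : W)) :
    Nonempty (V ≃ₗ⁅ℂ,𝔤⁆ W) := by
  have hH : ⨆ μ : ℂ, Module.End.eigenspace (LieAlgebra.ad ℂ 𝔤 H) μ = ⊤ := by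
    rcases hG with hG | ⟨F, hG⟩
    · exact hG.iSup_eigenspace_ad
    · exact hG.iSup_eigenspace_ad
  obtain ⟨ψ, hψ⟩ := hiso
  obtain ⟨v, hv, hv0⟩ := hev.exists_hasEigenvector
  have hw0 : (ψ ⟨v, hv⟩ : W) ≠ 0 := by simpa using hv0
  refine nonempty_lieModuleEquiv_of_ker_uOrbit_eq hsimpleV hsimpleW hv0 hw0 (le_antisymm ?_ ?_)
  · refine ker_uOrbit_le_ker_uOrbit hH hsimpleW hv (ψ ⟨v, hv⟩).2 hw0 fun u hu huv => ?_
    simpa using hψ ⟨u, hu⟩ ⟨v, hv⟩ 0 (by simpa using huv)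
  · refine ker_uOrbit_le_ker_uOrbit hH hsimpleV (ψ ⟨v, hv⟩).2 hv hv0 fun u hu huw => ?_
    have huv : uAction 𝔤 V u v ∈ Module.End.eigenspace (LieModule.toEnd ℂ 𝔤 V H) hc := by
      simpa using uAction_mem_eigenspace (mem_U0_iff.1 hu) hv
    have h := hψ ⟨u, hu⟩ ⟨v, hv⟩ ⟨_, huv⟩ rfl
    rw [huw] at h
    simpa using h.symm
end
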